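/- arXiv:1501.02444 — 9 statements merged into one kernel-verified Lean document; each statement's English description precedes it below -/
import Mathlib

section
/- For every p_e ∈ (0,1) there exists a constant β > 0 such that for every z ∈ [0,1] and every integer n ≥ 1 there exists a set S of binary strings of length n satisfying |S| ≥ 2^n·((1 − z) − β·2^(−n/3.639)) and ∑_{b ∈ S} F_b(z) ≤ p_e. (In coding terms: for transmission over the binary erasure channel with erasure probability z, a polar code with information set S has rate |S|/2^n ≥ (1−z) − β·2^(−n/3.639) and block error probability under successive cancellation decoding at most p_e; equivalently, block length N ≤ β'/((1−z) − R)^{3.639} suffices.) -/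
/-- One polarization step for the Bhattacharyya parameter of a BEC. -/
noncomputable def becStep (z : ℝ) (b : Bool) : ℝ := if b then z ^ 2 else 2 * z - z ^ 2

/-- `becF n b z` is the Bhattacharyya parameter of the synthetic channel indexed by the
binary string `b` obtained by polarizing a BEC with erasure probability `z`. -/
noncomputable def becF (n : ℕ) (b : Fin n → Bool) (z : ℝ) : ℝ :=
  (List.ofFn b).foldl becStep z

def bLines : List (ℤ × ℤ) :=
  [(14032609126, 1897), (13038699898, 2291), (12115187810, 2767), (11257086735, 3342), (10459763708, 4037),
   (9718913907, 4876), (9030537416, 5889), (8390917628, 7113), (7796601176, 8592), (7244379292, 10378),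
   (6731270477, 12536), (6254504411, 15142), (5811506990, 18290), (5399886430, 22092), (5017420354, 26686),
   (4662043791, 32234), (4331838032, 38936), (4025020265, 47031), (3739933953, 56810), (3475039888, 68621),
   (3228907884, 82889), (3000209050, 100123), (2787708621, 120941), (2590259287, 146087), (2406795001, 176461),
   (2236325223, 213151), (2077929571, 257470), (1930752851, 311004), (1794000444, 375668), (1666934011, 453778),
   (1655086055, 461908), (1631900580, 478756), (1608993080, 496250), (1586463242, 514332), (1564192272, 533118),
   (1542222018, 552594), (1520549821, 572787), (1499217484, 593674), (1478112833, 615390), (1457290187, 637909),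
   (1436755192, 661249), (1416491431, 685454), (1396510058, 710538), (1376800405, 736540), (1357309176, 763563),
   (1338104101, 791547), (1319123441, 820613), (1300418431, 850716), (1281932248, 881982), (1263715016, 914362),
   (1245715496, 947984), (1227977290, 982803), (1210437602, 1018985), (1193127811, 1056510), (1176028465, 1095466),
   (1159162159, 1135847), (1142519138, 1177720), (1126078471, 1221188), (1109822997, 1266353), (1093799143, 1313139),
   (1077968042, 1361713), (1062328345, 1412140), (1046878863, 1464488), (1031654473, 1518693), (1016582527, 1575083),
   (1001721030, 1633511), (987030937, 1694198), (972526570, 1757160), (958182436, 1822590), (944034318, 1890401),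
   (930054573, 1960804), (916228173, 2033969), (902567685, 2109923), (889079889, 2188723), (875762800, 2270466),
   (862581961, 2355474), (849559584, 2443718), (836716923, 2535150), (823986331, 2630372), (811428385, 2729060),
   (799012752, 2831562), (786741243, 2937997), (774597534, 3048648), (762611441, 3163380), (750755339, 3282596),
   (739019174, 3406563), (727420053, 3535266), (715953872, 3668910), (704625931, 3807591), (693402187, 3951916),
   (682304772, 4101801), (671350656, 4257189), (660483383, 4419090), (649753277, 4586978), (639132162, 4761495),
   (628627611, 4942748), (618219342, 5131336), (607934977, 5327004), (597756113, 5530342), (587674603, 5741791),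
   (577686372, 5961739), (567816268, 6189918), (558033320, 6427336), (548349034, 6674050), (538754428, 6930620),
   (529268282, 7196865), (519863739, 7473887), (510565547, 7761304), (501337542, 8060619), (492191034, 8371918),
   (483135657, 8695286), (474162023, 9031467), (465267307, 9381026), (456462733, 9743961), (447728254, 10121573),
   (439070299, 10514100), (430479218, 10922528), (421980018, 11346160), (413540136, 11787159), (405163195, 12245982),
   (396870156, 12722046), (388615731, 13218615), (380453884, 13733096), (372340243, 14268894), (364291550, 14825651),
   (356304317, 15404304), (348383028, 16005225), (340513835, 16630210), (332691394, 17280556), (324932775, 17955645),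
   (317237599, 18656239), (309576850, 19385871), (301959625, 20144726), (294414838, 20930713), (286908614, 21748201),
   (279441664, 22598170), (272026994, 23480143), (264653800, 24396348), (257325715, 25347360), (250033161, 26335501),
   (242783391, 27360871), (235571441, 28425246), (228389808, 29530902), (221256336, 30676180), (214158400, 31864117),
   (207085602, 33097690), (200047095, 34376508), (193036671, 35702936), (186069612, 37075114), (179118108, 38499727),
   (172194442, 39975610), (165301061, 41503381), (158431442, 43085660), (151574623, 44726315), (144764216, 46418339),
   (137958146, 48173254), (131176671, 49987199), (124418649, 51861506), (117679256, 53798560), (110954146, 55800759),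
   (104244597, 57868817), (97552577, 60003154), (90875215, 62205608), (84214244, 64476490), (77563654, 66818740),
   (70923121, 69233366), (64291241, 71721716), (57672150, 74282933), (51059945, 76919953), (44460830, 79630816),
   (37860538, 82421973), (31269065, 85289713), (24679247, 88237565), (18092915, 91265094), (11516339, 94369537),
   (4935724, 97557550), (0, 100002396)]

def bCells : List (ℤ × ℤ × ℕ × ℕ) :=
  [(68619, 72667, 2, 44), (72666, 76369, 2, 45), (76368, 80259, 2, 46), (80258, 84352, 3, 47),
   (84351, 88648, 3, 48), (88647, 93175, 3, 49), (93174, 97913, 4, 50), (97912, 102897, 4, 51),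
   (102896, 108147, 5, 52), (108146, 113660, 5, 53), (113659, 119450, 5, 54), (119449, 125537, 6, 55),
   (125536, 131926, 6, 56), (131925, 138642, 7, 57), (138641, 145712, 7, 58), (145711, 153135, 7, 59),
   (153134, 160936, 8, 60), (160935, 169132, 8, 61), (169131, 177744, 8, 62), (177743, 186794, 9, 63),
   (186793, 196294, 9, 64), (196293, 206287, 9, 65), (206286, 216785, 10, 66), (216784, 227822, 10, 67),
   (227821, 239419, 11, 68), (239418, 251595, 11, 69), (251594, 264394, 11, 70), (264393, 277845, 12, 71),
   (277844, 291978, 12, 72), (291977, 306827, 12, 73), (306826, 322430, 13, 74), (322429, 338834, 13, 75),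
   (338833, 356041, 14, 76), (356040, 374139, 14, 77), (374138, 393151, 14, 78), (393150, 413116, 15, 79),
   (413115, 434090, 15, 80), (434089, 456145, 15, 81), (456144, 479294, 16, 82), (479293, 503608, 16, 83),
   (503607, 529169, 17, 84), (529168, 556013, 17, 85), (556012, 584232, 17, 86), (584231, 613821, 18, 87),
   (613820, 644937, 18, 88), (644936, 677634, 18, 89), (677633, 711940, 19, 90), (711939, 747978, 19, 91),
   (747977, 785861, 20, 92), (785860, 825589, 20, 93), (825588, 867335, 20, 94), (867334, 911180, 21, 95),
   (911179, 957210, 21, 96), (957209, 1005525, 22, 97), (1005524, 1056283, 22, 98), (1056282, 1109593, 22, 99),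
   (1109592, 1165550, 23, 100), (1165549, 1224239, 23, 101), (1224238, 1285890, 23, 102), (1285889, 1350630, 24, 103),
   (1350629, 1418536, 24, 104), (1418535, 1489804, 25, 105), (1489803, 1564645, 25, 106), (1564644, 1643114, 25, 107),
   (1643113, 1725472, 26, 108), (1725471, 1811906, 26, 109), (1811905, 1902578, 26, 110), (1902577, 1997650, 27, 111),
   (1997649, 2097395, 27, 112), (2097394, 2202072, 28, 113), (2202071, 2311820, 28, 114), (2311819, 2426856, 28, 115),
   (2426855, 2547571, 29, 116), (2547570, 2674107, 30, 117), (2674106, 2806672, 32, 118), (2806671, 2945619, 34, 119),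
   (2945618, 3091107, 36, 120), (3091106, 3243551, 38, 121), (3243550, 3403474, 40, 122), (3403473, 3571006, 42, 123),
   (3571005, 3746320, 44, 124), (3746319, 3929963, 46, 125), (3929962, 4122119, 48, 126), (4122118, 4323235, 50, 127),
   (4323234, 4533715, 51, 128), (4533714, 4754094, 53, 129), (4754093, 4984375, 55, 130), (4984375, 5225180, 57, 131),
   (5225179, 5477215, 59, 132), (5477214, 5740526, 59, 134), (5740525, 6015792, 61, 135), (6015791, 6303488, 63, 136),
   (6303487, 6603670, 65, 137), (6603669, 6917360, 67, 138), (6917359, 7244725, 68, 139), (7244724, 7586152, 70, 140),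
   (7586151, 7942174, 72, 141), (7942173, 8313850, 74, 142), (8313849, 8701150, 76, 143), (8701149, 9104328, 78, 144),
   (9104327, 9524291, 80, 145), (9524290, 9962356, 82, 146), (9962355, 10417617, 84, 147), (10417616, 10890803, 86, 148),
   (10890802, 11383082, 88, 149), (11383081, 11894974, 90, 150), (11894973, 12426162, 92, 151), (12426161, 12977634, 94, 152),
   (12977633, 13550000, 96, 153), (13549999, 14143484, 98, 154), (14143483, 14758492, 98, 156), (14758491, 15395608, 99, 157),
   (15395607, 16054987, 101, 158), (16054986, 16736373, 103, 159), (16736372, 17441090, 105, 160), (17441089, 18168882, 107, 161),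
   (18168881, 18920796, 109, 162), (18920795, 19695226, 111, 163), (19695225, 20493594, 113, 164), (20493593, 21316497, 114, 165),
   (21316496, 22162869, 115, 167), (22162868, 23032995, 116, 168), (23032994, 23927349, 118, 169), (23927348, 24844683, 120, 170),
   (24844682, 25784558, 122, 171), (25784557, 26748532, 124, 172), (26748531, 27734551, 126, 173), (27734550, 28742263, 126, 175),
   (28742262, 29771989, 128, 176), (29771988, 30822609, 130, 352), (30822608, 31893764, 131, 350), (31893763, 32983894, 132, 349),
   (32983893, 34092357, 134, 348), (34092356, 35218680, 136, 347), (35218679, 36361931, 138, 346), (36361930, 37521035, 138, 344),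
   (37521034, 38694392, 140, 343), (38694391, 39881099, 142, 342), (39881098, 41079191, 143, 341), (41079190, 42288387, 144, 339),
   (42288386, 43506816, 146, 338), (43506815, 44733436, 147, 337), (44733435, 45966845, 149, 336), (45966844, 47204549, 150, 334),
   (47204548, 48445518, 151, 333), (48445517, 49533686, 153, 332), (49533685, 50000000, 154, 331)]


/-! ### The certificate: a concave function given by 177 lines and a power tail -/

def bLn (i : ℕ) : ℤ × ℤ := bLines.getD i (0, 0)

def bCell (i : ℕ) : ℤ × ℤ × ℕ × ℕ := bCells.getD i (0, 0, 0, 0)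

/-- Direct line (index below 177) or reflected line. -/
def bRl (k : ℕ) : ℤ × ℤ :=
  if k < 177 then bLn k else (-(bLn (k - 177)).1, (bLn (k - 177)).1 + (bLn (k - 177)).2)

def chkPos (i : ℕ) : Bool :=
  decide (0 ≤ (bLn i).1) && decide (1 ≤ (bLn i).2)

def chkMono (i : ℕ) : Bool := decide ((bLn (i + 1)).1 < (bLn i).1)

def chkTail (i : ℕ) : Bool :=
  decide (302840087 ^ 25 * 72 ^ 18 * 28 ^ 7 ≤ ((bLn i).1 * 100) ^ 18 * ((bLn i).2 * 100) ^ 7) &&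
  decide (((bLn (i + 1)).2 - (bLn i).2) * 100000000 ≤ ((bLn i).1 - (bLn (i + 1)).1) * 70000)

def chkEnd (l m r : ℤ × ℤ) (q : ℤ) : Bool :=
  decide (100000 * (m.1 * q ^ 2 + m.2 * 100000000 ^ 2 + r.1 * (2 * q * 100000000 - q ^ 2)
    + r.2 * 100000000 ^ 2) ≤ 2 * 82640 * (l.1 * q * 100000000 + l.2 * 100000000 ^ 2))

def chkPow (l : ℤ × ℤ) (q : ℤ) : Bool :=
  decide ((l.1 * q + l.2 * 100000000) ^ 25 ≤ 302852542 ^ 25 * q ^ 18 * 100000000 ^ 7)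

def chkCell (i : ℕ) : Bool :=
  let c := bCell i
  let k := bLn (i + 29)
  let l := bLn (i + 30)
  let r := bLn (i + 31)
  decide (0 ≤ c.1) && decide (c.1 < c.2.1) &&
  decide ((k.1 - l.1) * c.1 ≤ (l.2 - k.2) * 100000000) &&
  (if i = 146 then decide (c.2.1 = 50000000)
    else decide ((r.2 - l.2) * 100000000 ≤ (l.1 - r.1) * c.2.1)) &&
  decide (c.2.2.1 < 354) && decide (c.2.2.2 < 354) &&
  decide ((bRl c.2.2.2).1 ≤ (bRl c.2.2.1).1) &&
  chkEnd l (bRl c.2.2.1) (bRl c.2.2.2) c.1 && chkEnd l (bRl c.2.2.1) (bRl c.2.2.2) c.2.1 &&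
  (decide (140000 < c.1) || (chkPow l c.1 && chkPow l c.2.1))

theorem chkPos_all : (List.range 177).all chkPos = true := by decide +kernel
theorem chkMono_all : (List.range 176).all chkMono = true := by decide +kernel
theorem chkTail_all : (List.range 30).all chkTail = true := by decide +kernel
theorem chkCell_all : (List.range 147).all chkCell = true := by decide +kernel

theorem bLn_pos {i : ℕ} (hi : i < 177) : 0 ≤ (bLn i).1 ∧ 1 ≤ (bLn i).2 := by
  have h := List.all_eq_true.1 chkPos_all i (List.mem_range.2 hi)
  simpa [chkPos] using h

theorem bLn_mono {i : ℕ} (hi : i < 176) : (bLn (i + 1)).1 < (bLn i).1 := by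
  have h := List.all_eq_true.1 chkMono_all i (List.mem_range.2 hi)
  simpa [chkMono] using h

noncomputable def lv (l : ℤ × ℤ) (x : ℝ) : ℝ := (l.1 : ℝ) * x + (l.2 : ℝ)

noncomputable def pw (u : ℝ) : ℝ := u ^ ((18 : ℝ) / 25)

theorem pw_nonneg {u : ℝ} (hu : 0 ≤ u) : 0 ≤ pw u := Real.rpow_nonneg hu _

theorem pw_pow {u : ℝ} (hu : 0 ≤ u) : pw u ^ 25 = u ^ 18 := by
  unfold pw
  rw [← Real.rpow_natCast, ← Real.rpow_mul hu, ← Real.rpow_natCast]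
  norm_num

theorem le_pw {c u v : ℝ} (hc : 0 ≤ c) (hu : 0 ≤ u) (h : v ^ 25 ≤ c ^ 25 * u ^ 18) :
    v ≤ c * pw u := by
  have h2 : v ^ 25 ≤ (c * pw u) ^ 25 := by rw [mul_pow, pw_pow hu]; exact h
  exact le_of_pow_le_pow_left₀ (by norm_num) (mul_nonneg hc (pw_nonneg hu)) h2

theorem pw_le {c u v : ℝ} (hv : 0 ≤ v) (hu : 0 ≤ u) (h : c ^ 25 * u ^ 18 ≤ v ^ 25) :
    c * pw u ≤ v := by
  have h2 : (c * pw u) ^ 25 ≤ v ^ 25 := by rw [mul_pow, pw_pow hu]; exact h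
  exact le_of_pow_le_pow_left₀ (by norm_num) hv h2

theorem pw_mono {u v : ℝ} (hu : 0 ≤ u) (h : u ≤ v) : pw u ≤ pw v :=
  Real.rpow_le_rpow hu h (by norm_num)

theorem pw_mul {u v : ℝ} (hu : 0 ≤ u) (hv : 0 ≤ v) : pw (u * v) = pw u * pw v :=
  Real.mul_rpow hu hv

theorem tail_le {i : ℕ} (hi : i < 30) {u : ℝ} (hu : 0 ≤ u) :
    302840087 * pw u ≤ lv (bLn i) u := by
  have h := List.all_eq_true.1 chkTail_all i (List.mem_range.2 hi)
  simp only [chkTail, Bool.and_eq_true, decide_eq_true_eq] at h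
  have h1 := h.1
  obtain ⟨ha, hb⟩ := bLn_pos (show i < 177 by omega)
  unfold lv
  generalize bLn i = l at *
  have ha' : (0 : ℝ) ≤ l.1 := by exact_mod_cast ha
  have hb' : (0 : ℝ) ≤ l.2 := by exact_mod_cast (by omega : (0 : ℤ) ≤ l.2)
  have h1' : (302840087 : ℝ) ^ 25 * 72 ^ 18 * 28 ^ 7 ≤ ((l.1 : ℝ) * 100) ^ 18 * ((l.2 : ℝ) * 100) ^ 7 := by
    exact_mod_cast h1
  have am := Real.geom_mean_le_arith_mean2_weighted (w₁ := 18 / 25) (w₂ := 7 / 25)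
    (p₁ := (l.1 : ℝ) * u / (18 / 25)) (p₂ := (l.2 : ℝ) / (7 / 25)) (by norm_num) (by norm_num)
    (by positivity) (by positivity) (by norm_num)
  have e : (18 / 25 : ℝ) * ((l.1 : ℝ) * u / (18 / 25)) + 7 / 25 * ((l.2 : ℝ) / (7 / 25))
      = l.1 * u + l.2 := by ring
  rw [e] at am
  refine le_trans ?_ am
  refine pw_le (by positivity) hu ?_
  rw [mul_pow, ← Real.rpow_natCast (_ ^ (18 / 25 : ℝ)), ← Real.rpow_natCast (_ ^ (7 / 25 : ℝ)),
    ← Real.rpow_mul (by positivity), ← Real.rpow_mul (by positivity)]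
  have e1 : (18 / 25 : ℝ) * ((25 : ℕ) : ℝ) = ((18 : ℕ) : ℝ) := by norm_num
  have e2 : (7 / 25 : ℝ) * ((25 : ℕ) : ℝ) = ((7 : ℕ) : ℝ) := by norm_num
  rw [e1, e2, Real.rpow_natCast, Real.rpow_natCast]
  have hu18 : 0 ≤ u ^ 18 := by positivity
  have := mul_le_mul_of_nonneg_right h1' hu18
  have e3 : ((l.1 : ℝ) * u / (18 / 25)) ^ 18 * ((l.2 : ℝ) / (7 / 25)) ^ 7
      = (((l.1 : ℝ) * 100) ^ 18 * ((l.2 : ℝ) * 100) ^ 7 * u ^ 18) / (72 ^ 18 * 28 ^ 7) := by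
    rw [eq_div_iff (by positivity)]
    have : (72 : ℝ) ^ 18 * 28 ^ 7 = (18 / 25) ^ 18 * (7 / 25) ^ 7 * 100 ^ 18 * 100 ^ 7 := by norm_num
    rw [this, div_pow, div_pow, mul_pow, mul_pow, mul_pow]
    field_simp
  rw [e3, le_div_iff₀ (by positivity)]
  refine le_trans (le_of_eq ?_) this
  ring

theorem tail_cross {i : ℕ} (hi : i < 30) {u : ℝ} (h : lv (bLn i) u ≤ lv (bLn (i + 1)) u) :
    u ≤ 7 / 10000 := by
  have h' := List.all_eq_true.1 chkTail_all i (List.mem_range.2 hi)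
  simp only [chkTail, Bool.and_eq_true, decide_eq_true_eq] at h'
  have h2 := h'.2
  have hm := bLn_mono (show i < 176 by omega)
  unfold lv at h
  generalize bLn i = l at *
  generalize bLn (i + 1) = r at *
  have h2' : ((r.2 : ℝ) - l.2) * 100000000 ≤ (l.1 - r.1) * 70000 := by exact_mod_cast h2
  have hm' : (0 : ℝ) < l.1 - r.1 := by
    have : (r.1 : ℝ) < l.1 := by exact_mod_cast hm
    linarith
  by_contra hc
  push Not at hc
  nlinarith

noncomputable def bMin (u : ℝ) : ℝ :=
  (Finset.range 177).inf' ⟨0, by simp⟩ (fun i => lv (bLn i) u)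

noncomputable def bH (u : ℝ) : ℝ :=
  if u ≤ 7 / 10000 then min (bMin u) (302840087 * pw u) else bMin u

noncomputable def bh (x : ℝ) : ℝ := bH (min x (1 - x))

theorem bMin_le {i : ℕ} (hi : i < 177) (u : ℝ) : bMin u ≤ lv (bLn i) u :=
  Finset.inf'_le _ (Finset.mem_range.2 hi)

theorem bH_le_bMin (u : ℝ) : bH u ≤ bMin u := by
  unfold bH
  split_ifs
  · exact min_le_left _ _
  · exact le_rfl

theorem bh_le_line {i : ℕ} (hi : i < 177) (x : ℝ) : bh x ≤ lv (bLn i) x := by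
  refine (bH_le_bMin _).trans ((bMin_le hi _).trans ?_)
  have ha : (0 : ℝ) ≤ (bLn i).1 := by exact_mod_cast (bLn_pos hi).1
  unfold lv
  have := mul_le_mul_of_nonneg_left (min_le_left x (1 - x)) ha
  linarith

theorem bh_symm (x : ℝ) : bh (1 - x) = bh x := by
  unfold bh
  rw [min_comm]
  congr 2
  ring

theorem bh_le_rl {k : ℕ} (hk : k < 354) (x : ℝ) : bh x ≤ lv (bRl k) x := by
  unfold bRl
  split_ifs with h
  · exact bh_le_line h x
  · rw [← bh_symm]
    refine (bh_le_line (show k - 177 < 177 by omega) (1 - x)).trans (le_of_eq ?_)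
    unfold lv
    push_cast
    ring

theorem cell_prop {i : ℕ} (hi : i < 147) :
    ∃ s e : ℝ, ∃ m r : ℤ × ℤ, 0 ≤ s ∧ s < e ∧
      (∀ u : ℝ, u ≤ 1 / 2 → lv (bLn (i + 30)) u ≤ lv (bLn (i + 29)) u →
        (i < 146 → lv (bLn (i + 30)) u ≤ lv (bLn (i + 31)) u) → s ≤ u ∧ u ≤ e) ∧
      (∀ x, bh x ≤ lv m x) ∧ (∀ x, bh x ≤ lv r x) ∧ (r.1 : ℝ) ≤ m.1 ∧
      (lv m (s ^ 2) + lv r (2 * s - s ^ 2) ≤ 2 * 0.8264 * lv (bLn (i + 30)) s) ∧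
      (lv m (e ^ 2) + lv r (2 * e - e ^ 2) ≤ 2 * 0.8264 * lv (bLn (i + 30)) e) ∧
      (s ≤ 14 / 10000 → lv (bLn (i + 30)) s ≤ 302852542 * pw s ∧
        lv (bLn (i + 30)) e ≤ 302852542 * pw e) := by
  have h := List.all_eq_true.1 chkCell_all i (List.mem_range.2 hi)
  have hm1 := bLn_mono (show i + 29 < 176 by omega)
  have hm2 : i < 146 → (bLn (i + 31)).1 < (bLn (i + 30)).1 := fun h =>
    bLn_mono (show i + 30 < 176 by omega)
  simp only [chkCell, Bool.and_eq_true, decide_eq_true_eq, Bool.or_eq_true] at h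
  obtain ⟨⟨⟨⟨⟨⟨⟨⟨⟨h0, h1⟩, h2⟩, h3⟩, h4⟩, h5⟩, h6⟩, h7⟩, h8⟩, h9⟩ := h
  generalize bCell i = c at *
  obtain ⟨s, e, j, k⟩ := c
  dsimp only at h0 h1 h2 h3 h4 h5 h6 h7 h8 h9
  have hs0 : (0 : ℝ) ≤ s := by exact_mod_cast h0
  have hse : (s : ℝ) < e := by exact_mod_cast h1
  have endp : ∀ (l m r : ℤ × ℤ) (q : ℤ), chkEnd l m r q = true →
      lv m (((q : ℝ) / 100000000) ^ 2) + lv r (2 * ((q : ℝ) / 100000000) - ((q : ℝ) / 100000000) ^ 2)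
        ≤ 2 * 0.8264 * lv l ((q : ℝ) / 100000000) := by
    intro l m r q hq
    simp only [chkEnd, decide_eq_true_eq] at hq
    have hq' : (100000 * (m.1 * q ^ 2 + m.2 * 100000000 ^ 2 + r.1 * (2 * q * 100000000 - q ^ 2)
      + r.2 * 100000000 ^ 2) : ℝ) ≤ 2 * 82640 * (l.1 * q * 100000000 + l.2 * 100000000 ^ 2) := by
      exact_mod_cast hq
    unfold lv
    ring_nf at hq' ⊢
    linarith
  have powp : ∀ (l : ℤ × ℤ) (q : ℤ), 0 ≤ (q : ℝ) → chkPow l q = true →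
      lv l ((q : ℝ) / 100000000) ≤ 302852542 * pw ((q : ℝ) / 100000000) := by
    intro l q hq0 hq
    simp only [chkPow, decide_eq_true_eq] at hq
    have hq' : ((l.1 * q + l.2 * 100000000) ^ 25 : ℝ) ≤ 302852542 ^ 25 * q ^ 18 * 100000000 ^ 7 := by
      exact_mod_cast hq
    refine le_pw (by norm_num) (by positivity) ?_
    have e1 : lv l ((q : ℝ) / 100000000) = (l.1 * q + l.2 * 100000000) / 100000000 := by
      unfold lv; ring
    rw [e1, div_pow, div_pow, div_le_iff₀ (by positivity)]
    refine hq'.trans (le_of_eq ?_)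
    ring
  refine ⟨(s : ℝ) / 100000000, (e : ℝ) / 100000000, bRl j, bRl k, by positivity, by linarith, ?_,
    fun x => bh_le_rl h4 x, fun x => bh_le_rl h5 x, by exact_mod_cast h6, endp _ _ _ _ h7,
    endp _ _ _ _ h8, ?_⟩
  · intro u hu hl hr
    constructor
    · by_contra hc
      push Not at hc
      have h2' : ((bLn (i + 29)).1 - (bLn (i + 30)).1 : ℝ) * s
          ≤ ((bLn (i + 30)).2 - (bLn (i + 29)).2) * 100000000 := by exact_mod_cast h2
      have hm1' : ((bLn (i + 30)).1 : ℝ) < (bLn (i + 29)).1 := by exact_mod_cast hm1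
      unfold lv at hl
      have hp : 0 < (((bLn (i + 29)).1 : ℝ) - (bLn (i + 30)).1) * ((s : ℝ) / 100000000 - u) :=
        mul_pos (by linarith) (by linarith)
      ring_nf at hp hl h2'
      linarith
    · split_ifs at h3 with h146
      · have : (e : ℝ) = 50000000 := by
          have h3' := of_decide_eq_true h3
          exact_mod_cast h3'
        rw [this]
        linarith
      · have hlt : i < 146 := by omega
        have hr' := hr hlt
        have h3' := of_decide_eq_true h3
        have hm2' : ((bLn (i + 31)).1 : ℝ) < (bLn (i + 30)).1 := by exact_mod_cast hm2 hlt
        have h3'' : ((bLn (i + 31)).2 - (bLn (i + 30)).2 : ℝ) * 100000000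
          ≤ ((bLn (i + 30)).1 - (bLn (i + 31)).1) * e := by exact_mod_cast h3'
        by_contra hc
        push Not at hc
        unfold lv at hr'
        have hp : 0 < (((bLn (i + 30)).1 : ℝ) - (bLn (i + 31)).1) * (u - (e : ℝ) / 100000000) :=
          mul_pos (by linarith) (by linarith)
        ring_nf at hp hr' h3''
        linarith
  · intro hs
    rcases h9 with h9 | h9
    · exfalso
      have : (140000 : ℝ) < s := by exact_mod_cast h9
      linarith
    · exact ⟨powp _ _ hs0 h9.1, powp _ _ (by linarith) h9.2⟩

/-- A line active in the minimum is either a tail line, or the point lies in its cell. -/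
theorem active_cases {u : ℝ} : ∃ i, i < 177 ∧ bMin u = lv (bLn i) u ∧
    ∀ j, j < 177 → lv (bLn i) u ≤ lv (bLn j) u := by
  obtain ⟨i, hi, h⟩ := Finset.exists_mem_eq_inf' (s := Finset.range 177) ⟨0, by simp⟩
    (fun i => lv (bLn i) u)
  refine ⟨i, Finset.mem_range.1 hi, h, fun j hj => ?_⟩
  have := bMin_le hj u
  unfold bMin at this
  rw [h] at this
  exact this

theorem pw_chord {l : ℤ × ℤ} {s e y c : ℝ} (hc : 0 ≤ c) (hs : 0 ≤ s) (hse : s < e) (h1 : s ≤ y) (h2 : y ≤ e)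
    (hl : lv l s ≤ c * pw s) (hr : lv l e ≤ c * pw e) : lv l y ≤ c * pw y := by
  have he : 0 ≤ e := by linarith
  have cc0 := (Real.concaveOn_rpow (p := 18 / 25) (by norm_num) (by norm_num)).2
  have cc := @cc0 s hs e he ((e - y) / (e - s)) ((y - s) / (e - s))
    (div_nonneg (by linarith) (by linarith)) (div_nonneg (by linarith) (by linarith))
    (by rw [← add_div]; rw [div_eq_one_iff_eq (by linarith)]; ring)
  have hne : e - s ≠ 0 := by linarith
  have ey : (e - y) / (e - s) * s + (y - s) / (e - s) * e = y := by
    field_simp; ring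
  simp only [smul_eq_mul] at cc
  rw [ey] at cc
  change (e - y) / (e - s) * pw s + (y - s) / (e - s) * pw e ≤ pw y at cc
  have e1 : lv l y = (e - y) / (e - s) * lv l s + (y - s) / (e - s) * lv l e := by
    unfold lv
    field_simp; ring
  have A : 0 ≤ (e - y) / (e - s) := div_nonneg (by linarith) (by linarith)
  have B : 0 ≤ (y - s) / (e - s) := div_nonneg (by linarith) (by linarith)
  have := mul_le_mul_of_nonneg_left hl A
  have := mul_le_mul_of_nonneg_left hr B
  have := mul_le_mul_of_nonneg_left cc hc
  rw [e1]
  nlinarith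

theorem quad_concave {A B K s e x : ℝ} (hA : A ≤ 0) (h1 : s ≤ x) (h2 : x ≤ e) (hse : s < e)
    (hs : 0 ≤ A * s ^ 2 + B * s + K) (he : 0 ≤ A * e ^ 2 + B * e + K) :
    0 ≤ A * x ^ 2 + B * x + K := by
  have key : (e - s) * (A * x ^ 2 + B * x + K) = (e - x) * (A * s ^ 2 + B * s + K)
      + (x - s) * (A * e ^ 2 + B * e + K) + (-A) * ((x - s) * (e - x) * (e - s)) := by ring
  have : 0 ≤ (e - s) * (A * x ^ 2 + B * x + K) := by
    rw [key]
    have a1 : 0 ≤ e - x := by linarith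
    have a2 : 0 ≤ x - s := by linarith
    have a3 : 0 ≤ e - s := by linarith
    have a4 : 0 ≤ -A := by linarith
    positivity
  exact nonneg_of_mul_nonneg_right this (by linarith)

theorem bH_le_pw {y : ℝ} (hy0 : 0 ≤ y) (hy : y ≤ 14 / 10000) : bH y ≤ 302852542 * pw y := by
  have hp := pw_nonneg hy0
  by_cases h : y ≤ 7 / 10000
  · have : bH y ≤ 302840087 * pw y := by
      unfold bH; rw [if_pos h]; exact min_le_right _ _
    linarith
  · refine (bH_le_bMin y).trans ?_
    obtain ⟨i, hi, h1, h2⟩ := active_cases (u := y)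
    rw [h1]
    by_cases hi30 : i < 30
    · exact absurd (tail_cross hi30 (h2 (i + 1) (by omega))) h
    · obtain ⟨k, rfl⟩ : ∃ k, i = k + 30 := ⟨i - 30, by omega⟩
      obtain ⟨s, e, m, r, hs0, hse, hc, -, -, -, -, -, hpow⟩ := cell_prop (show k < 147 by omega)
      obtain ⟨b1, b2⟩ := hc y (by linarith) (h2 (k + 29) (by omega)) (fun hk => h2 (k + 31) (by omega))
      obtain ⟨p1, p2⟩ := hpow (by linarith)
      exact pw_chord (by norm_num) hs0 hse b1 b2 p1 p2

theorem bh_contract_half {x : ℝ} (h0 : 0 ≤ x) (h1 : x ≤ 1 / 2) :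
    bh (x ^ 2) + bh (2 * x - x ^ 2) ≤ 2 * 0.8264 * bh x := by
  have hx : bh x = bH x := by unfold bh; rw [min_eq_left (by linarith)]
  -- the power tail
  have tail : x ≤ 7 / 10000 → bh (x ^ 2) + bh (2 * x - x ^ 2) ≤ 2 * 0.8264 * (302840087 * pw x) := by
    intro hx0
    have q1 : x ^ 2 ≤ x := by nlinarith
    have e1 : bh (x ^ 2) ≤ 302840087 * pw (x ^ 2) := by
      unfold bh
      rw [min_eq_left (by linarith)]
      unfold bH
      rw [if_pos (by linarith)]
      exact min_le_right _ _
    have e2 : bh (2 * x - x ^ 2) ≤ 302852542 * pw (2 * x) := by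
      unfold bh
      rw [min_eq_left (by nlinarith)]
      refine (bH_le_pw (by nlinarith) (by nlinarith)).trans ?_
      have := pw_mono (show 0 ≤ 2 * x - x ^ 2 by nlinarith) (show 2 * x - x ^ 2 ≤ 2 * x by nlinarith)
      linarith
    rw [pw_mul (by norm_num) h0] at e2
    rw [sq, pw_mul h0 h0, ← sq] at e1
    have c1 : 1 * pw 2 ≤ 1.64719 := pw_le (by norm_num) (by norm_num) (by norm_num)
    have c2 : 1 * pw (7 / 10000) ≤ 0.0054 := pw_le (by norm_num) (by norm_num) (by norm_num)
    have c3 := pw_mono h0 hx0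
    have hp := pw_nonneg h0
    have m1 : pw x * pw x ≤ 0.0054 * pw x := mul_le_mul_of_nonneg_right (by linarith) hp
    have m2 : pw 2 * pw x ≤ 1.64719 * pw x := mul_le_mul_of_nonneg_right (by linarith) hp
    linarith
  -- cases
  by_cases hcase : x ≤ 7 / 10000 ∧ 302840087 * pw x ≤ bMin x
  · have : bH x = 302840087 * pw x := by
      unfold bH; rw [if_pos hcase.1, min_eq_right hcase.2]
    rw [hx, this]
    exact tail hcase.1
  · have hH : bH x = bMin x := by
      unfold bH
      split_ifs with h
      · refine min_eq_left ?_
        by_contra hc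
        exact hcase ⟨h, (not_le.1 hc).le⟩
      · rfl
    obtain ⟨i, hi, ha, hb⟩ := active_cases (u := x)
    by_cases hi30 : i < 30
    · exfalso
      apply hcase
      refine ⟨tail_cross hi30 (hb (i + 1) (by omega)), ?_⟩
      rw [ha]
      exact tail_le hi30 h0
    · obtain ⟨k, rfl⟩ : ∃ k, i = k + 30 := ⟨i - 30, by omega⟩
      obtain ⟨s, e, m, r, hs0, hse, hc, hm, hr, hmr, q1, q2, -⟩ := cell_prop (show k < 147 by omega)
      obtain ⟨b1, b2⟩ := hc x (by linarith) (hb (k + 29) (by omega)) (fun hk => hb (k + 31) (by omega))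
      rw [hx, hH, ha]
      have u1 := hm (x ^ 2)
      have u2 := hr (2 * x - x ^ 2)
      generalize bLn (k + 30) = l at *
      unfold lv at *
      have := quad_concave (A := (r.1 : ℝ) - m.1) (B := 2 * 0.8264 * l.1 - 2 * r.1)
        (K := 2 * 0.8264 * l.2 - m.2 - r.2) (by linarith) b1 b2 hse (by linarith) (by linarith)
      linarith

theorem bh_contract {x : ℝ} (h0 : 0 ≤ x) (h1 : x ≤ 1) :
    bh (x ^ 2) + bh (2 * x - x ^ 2) ≤ 2 * 0.8264 * bh x := by
  rcases le_total x (1 / 2) with h | h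
  · exact bh_contract_half h0 h
  · have := bh_contract_half (x := 1 - x) (by linarith) (by linarith)
    rw [bh_symm, ← bh_symm ((1 - x) ^ 2), ← bh_symm (2 * (1 - x) - (1 - x) ^ 2)] at this
    have e1 : 1 - (1 - x) ^ 2 = 2 * x - x ^ 2 := by ring
    have e2 : 1 - (2 * (1 - x) - (1 - x) ^ 2) = x ^ 2 := by ring
    rw [e1, e2] at this
    linarith

theorem bh_lower {x : ℝ} (h0 : 0 ≤ x) (h1 : x ≤ 1) : x * (1 - x) ≤ bh x := by
  have key : ∀ u : ℝ, 0 ≤ u → u ≤ 1 → u ≤ bH u := by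
    intro u hu hu1
    have hM : u ≤ bMin u := by
      refine Finset.le_inf' _ _ fun i hi => ?_
      obtain ⟨ha, hb⟩ := bLn_pos (Finset.mem_range.1 hi)
      have ha' : (0 : ℝ) ≤ (bLn i).1 := by exact_mod_cast ha
      have hb' : (1 : ℝ) ≤ (bLn i).2 := by exact_mod_cast hb
      unfold lv
      have := mul_nonneg ha' hu
      linarith
    unfold bH
    split_ifs
    · refine le_min hM ?_
      have : u ≤ pw u := by
        have := Real.rpow_le_rpow_of_exponent_ge' hu hu1 (show (0:ℝ) ≤ 18 / 25 by norm_num)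
          (show (18 / 25 : ℝ) ≤ 1 by norm_num)
        rwa [Real.rpow_one] at this
      have := pw_nonneg hu
      linarith
    · exact hM
  have hm : x * (1 - x) ≤ min x (1 - x) := le_min (by nlinarith) (by nlinarith)
  exact hm.trans (key _ (le_min h0 (by linarith)) ((min_le_left _ _).trans h1))

theorem bh_upper : ∃ K : ℝ, 0 < K ∧ ∀ x : ℝ, 0 ≤ x → x ≤ 1 → bh x ≤ K := by
  obtain ⟨ha, hb⟩ := bLn_pos (show 0 < 177 by norm_num)
  have ha' : (0 : ℝ) ≤ (bLn 0).1 := by exact_mod_cast ha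
  have hb' : (1 : ℝ) ≤ (bLn 0).2 := by exact_mod_cast hb
  refine ⟨(bLn 0).1 + (bLn 0).2, by linarith, fun x h0 h1 => (bh_le_line (i := 0) (by norm_num) x).trans ?_⟩
  unfold lv
  nlinarith

/-! ### Mixing in a small power -/

theorem two_rpow_small : (2 : ℝ) ^ ((1 : ℝ) / 20000) ≤ 1.00005 := by
  have h : (2 : ℝ) ≤ (1.00005 : ℝ) ^ 20000 := by
    have := one_add_mul_le_pow (show (-2 : ℝ) ≤ 0.00005 by norm_num) 20000
    norm_num at this ⊢
    linarith
  calc (2 : ℝ) ^ ((1 : ℝ) / 20000) ≤ ((1.00005 : ℝ) ^ 20000) ^ ((1 : ℝ) / 20000) :=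
        Real.rpow_le_rpow (by norm_num) h (by norm_num)
    _ = 1.00005 := by
        rw [← Real.rpow_natCast, ← Real.rpow_mul (by norm_num)]
        norm_num

theorem rate_bound : (0.8265 : ℝ) * 2 ^ ((1 : ℝ) / 20000) ≤ 2 ^ (-(1 : ℝ) / 3.639) := by
  have h1 := two_rpow_small
  have h2 : (0.826556 : ℝ) ≤ 2 ^ (-(36 : ℝ) / 131) := by
    have e : (2 : ℝ) ^ (-(36 : ℝ) / 131) = ((2 : ℝ)⁻¹ ^ 36) ^ ((1 : ℝ) / 131) := by
      rw [← Real.rpow_natCast, ← Real.rpow_mul (by norm_num), ← Real.rpow_neg_one,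
        ← Real.rpow_mul (by norm_num)]
      norm_num
    have e2 : (0.826556 : ℝ) = ((0.826556 : ℝ) ^ 131) ^ ((1 : ℝ) / 131) := by
      rw [← Real.rpow_natCast, ← Real.rpow_mul (by norm_num)]
      norm_num
    rw [e, e2]
    exact Real.rpow_le_rpow (by norm_num) (by norm_num) (by norm_num)
  have h3 : (2 : ℝ) ^ (-(36 : ℝ) / 131) ≤ 2 ^ (-(1 : ℝ) / 3.639) :=
    Real.rpow_le_rpow_of_exponent_le (by norm_num) (by norm_num)
  linarith

noncomputable def sg (x : ℝ) : ℝ := x ^ ((1 : ℝ) / 20000) * (1 - x)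

theorem exists_G : ∃ G : ℝ → ℝ, ∃ K δ : ℝ, 0 < K ∧ 0 < δ ∧
    (∀ x, 0 ≤ x → x ≤ 1 → G x ≤ K) ∧
    (∀ x, 0 ≤ x → x ≤ 1 → δ * sg x ≤ G x) ∧
    (∀ x, 0 ≤ x → x ≤ 1 → G (x ^ 2) + G (2 * x - x ^ 2) ≤ 2 * 0.8265 * G x) := by
  obtain ⟨K, hK, hKb⟩ := bh_upper
  obtain ⟨x1, hx1⟩ : ∃ x1 : ℝ, x1 = (0.3 : ℝ) ^ 20000 := ⟨_, rfl⟩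
  have hx1pos : 0 < x1 := by rw [hx1]; exact pow_pos (by norm_num) _
  have hx1s : x1 ≤ 0.3 := by
    rw [hx1]
    calc (0.3 : ℝ) ^ 20000 ≤ 0.3 ^ 1 := pow_le_pow_of_le_one (by norm_num) (by norm_num) (by norm_num)
      _ = 0.3 := pow_one _
  have hx1a : x1 ^ ((1 : ℝ) / 20000) = 0.3 := by
    rw [hx1, ← Real.rpow_natCast, ← Real.rpow_mul (by norm_num)]
    norm_num
  have hsg0 : ∀ x, 0 ≤ x → x ≤ 1 → 0 ≤ sg x := fun x h0 h1 =>
    mul_nonneg (Real.rpow_nonneg h0 _) (by linarith)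
  have hxa1 : ∀ x : ℝ, 0 ≤ x → x ≤ 1 → x ^ ((1 : ℝ) / 20000) ≤ 1 := fun x h0 h1 =>
    Real.rpow_le_one h0 h1 (by norm_num)
  -- action of the step on `sg`
  have hstep : ∀ x, 0 ≤ x → x ≤ 1 → sg (x ^ 2) + sg (2 * x - x ^ 2) ≤
      sg x * ((1 + x) * x ^ ((1 : ℝ) / 20000) + 1.00005 * (1 - x)) := by
    intro x h0 h1
    have hxp : 0 ≤ x ^ ((1 : ℝ) / 20000) := Real.rpow_nonneg h0 _
    have e1 : sg (x ^ 2) = sg x * ((1 + x) * x ^ ((1 : ℝ) / 20000)) := by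
      unfold sg
      rw [sq, Real.mul_rpow h0 h0]
      ring
    have e2 : sg (2 * x - x ^ 2) ≤ sg x * (1.00005 * (1 - x)) := by
      unfold sg
      have a1 : (2 * x - x ^ 2) ^ ((1 : ℝ) / 20000) ≤ 1.00005 * x ^ ((1 : ℝ) / 20000) := by
        calc (2 * x - x ^ 2) ^ ((1 : ℝ) / 20000) ≤ (2 * x) ^ ((1 : ℝ) / 20000) :=
              Real.rpow_le_rpow (by nlinarith) (by nlinarith) (by norm_num)
          _ = 2 ^ ((1 : ℝ) / 20000) * x ^ ((1 : ℝ) / 20000) := Real.mul_rpow (by norm_num) h0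
          _ ≤ _ := mul_le_mul_of_nonneg_right two_rpow_small hxp
      have a2 : 1 - (2 * x - x ^ 2) = (1 - x) * (1 - x) := by ring
      rw [a2]
      have a3 : 0 ≤ (1 - x) * (1 - x) := mul_self_nonneg _
      have := mul_le_mul_of_nonneg_right a1 a3
      refine this.trans (le_of_eq ?_)
      ring
    rw [e1, mul_add]
    linarith
  refine ⟨fun x => bh x + x1 / 100000 * sg x, K + 1, x1 / 100000, by linarith, by positivity, ?_, ?_, ?_⟩
  · intro x h0 h1
    have a := hKb x h0 h1
    have b : sg x ≤ 1 := by
      unfold sg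
      have := hxa1 x h0 h1
      have := Real.rpow_nonneg h0 ((1 : ℝ) / 20000)
      nlinarith
    have := hsg0 x h0 h1
    have c : x1 / 100000 * sg x ≤ 1 * 1 := mul_le_mul (by linarith) b this (by norm_num)
    simp only
    linarith
  · intro x h0 h1
    have := bh_lower h0 h1
    have : 0 ≤ x * (1 - x) := mul_nonneg h0 (by linarith)
    simp only
    linarith
  · intro x h0 h1
    have c := bh_contract h0 h1
    have s := hstep x h0 h1
    have l := bh_lower h0 h1
    have hs := hsg0 x h0 h1
    have hxp : 0 ≤ x ^ ((1 : ℝ) / 20000) := Real.rpow_nonneg h0 _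
    have l0 : 0 ≤ x * (1 - x) := mul_nonneg h0 (by linarith)
    have hd : 0 ≤ x1 / 100000 := by positivity
    simp only
    rcases le_total x x1 with hx | hx
    · have a : x ^ ((1 : ℝ) / 20000) ≤ 0.3 := by
        rw [← hx1a]; exact Real.rpow_le_rpow h0 hx (by norm_num)
      have b : (1 + x) * x ^ ((1 : ℝ) / 20000) + 1.00005 * (1 - x) ≤ 2 * 0.8265 := by
        have : (1 + x) * x ^ ((1 : ℝ) / 20000) ≤ (1 + x) * 0.3 :=
          mul_le_mul_of_nonneg_left a (by linarith)
        linarith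
      have d := mul_le_mul_of_nonneg_left b hs
      have e := mul_le_mul_of_nonneg_left (s.trans d) hd
      linarith
    · have a := hxa1 x h0 h1
      have b : (1 + x) * x ^ ((1 : ℝ) / 20000) + 1.00005 * (1 - x) ≤ 4 := by
        have : (1 + x) * x ^ ((1 : ℝ) / 20000) ≤ (1 + x) * 1 :=
          mul_le_mul_of_nonneg_left a (by linarith)
        linarith
      have d := mul_le_mul_of_nonneg_left b hs
      have sg1 : sg x ≤ 1 - x := by
        unfold sg
        have := mul_le_mul_of_nonneg_right a (show 0 ≤ 1 - x by linarith)
        linarith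
      have f : x1 * sg x ≤ x * (1 - x) :=
        mul_le_mul hx sg1 hs h0
      have e := mul_le_mul_of_nonneg_left (s.trans d) hd
      have g : 0 ≤ x1 * sg x := mul_nonneg hx1pos.le hs
      linarith

/-! ### Summation over binary strings -/

theorem becStep_mem {z : ℝ} (h0 : 0 ≤ z) (h1 : z ≤ 1) (b : Bool) :
    0 ≤ becStep z b ∧ becStep z b ≤ 1 := by
  unfold becStep
  split_ifs
  · exact ⟨by positivity, by nlinarith⟩
  · exact ⟨by nlinarith, by nlinarith [sq_nonneg (1 - z)]⟩

theorem becF_cons (n : ℕ) (c : Bool) (b : Fin n → Bool) (z : ℝ) :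
    becF (n + 1) (Fin.cons c b) z = becF n b (becStep z c) := by
  unfold becF
  rw [List.ofFn_cons, List.foldl_cons]

theorem sum_succ (φ : ℝ → ℝ) (n : ℕ) (z : ℝ) :
    ∑ b : Fin (n + 1) → Bool, φ (becF (n + 1) b z) =
      ∑ b : Fin n → Bool, φ (becF n b (z ^ 2)) + ∑ b : Fin n → Bool, φ (becF n b (2 * z - z ^ 2)) := by
  rw [← (Fin.consEquiv (fun _ : Fin (n + 1) => Bool)).sum_comp, Fintype.sum_prod_type]
  simp [Fin.consEquiv, becF_cons, becStep]

theorem becF_zero (b : Fin 0 → Bool) (z : ℝ) : becF 0 b z = z := by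
  simp [becF]

theorem becF_mem (n : ℕ) (b : Fin n → Bool) {z : ℝ} (h0 : 0 ≤ z) (h1 : z ≤ 1) :
    0 ≤ becF n b z ∧ becF n b z ≤ 1 := by
  unfold becF
  generalize List.ofFn b = l
  induction l generalizing z with
  | nil => exact ⟨h0, h1⟩
  | cons c l ih =>
    rw [List.foldl_cons]
    exact ih (becStep_mem h0 h1 c).1 (becStep_mem h0 h1 c).2

theorem sum_one_sub (n : ℕ) (z : ℝ) :
    ∑ b : Fin n → Bool, (1 - becF n b z) = 2 ^ n * (1 - z) := by
  induction n generalizing z with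
  | zero => simp [becF_zero]
  | succ n ih =>
    rw [sum_succ (fun x => 1 - x), ih, ih]
    ring

theorem sum_G {G : ℝ → ℝ} (hG : ∀ x, 0 ≤ x → x ≤ 1 → G (x ^ 2) + G (2 * x - x ^ 2) ≤ 2 * 0.8265 * G x)
    (n : ℕ) {z : ℝ} (h0 : 0 ≤ z) (h1 : z ≤ 1) :
    ∑ b : Fin n → Bool, G (becF n b z) ≤ (2 * 0.8265) ^ n * G z := by
  induction n generalizing z with
  | zero => simp [becF_zero]
  | succ n ih =>
    rw [sum_succ]
    have a := ih (z := z ^ 2) (by positivity) (by nlinarith)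
    have b := ih (z := 2 * z - z ^ 2) (by nlinarith) (by nlinarith [sq_nonneg (1 - z)])
    have c := mul_le_mul_of_nonneg_left (hG z h0 h1) (show (0 : ℝ) ≤ (2 * 0.8265) ^ n by positivity)
    rw [pow_succ (2 * 0.8265 : ℝ) n]
    linarith

/-- **Valid choice of scaling exponent `μ = 3.639` for the BEC.**
For every `p_e ∈ (0,1)` there is a constant `β > 0` such that for every erasure
probability `z ∈ [0,1]` and every `n ≥ 1` there is an information set `S` of binary
strings of length `n` with `|S| ≥ 2^n·((1 − z) − β·2^(−n/3.639))` and with the sum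
of the Bhattacharyya parameters over `S` (which upper bounds the block error
probability under successive cancellation decoding) at most `p_e`. -/
theorem bec_scaling_exponent_3_639
    (pe : ℝ) (hpe : pe ∈ Set.Ioo (0:ℝ) 1) :
    ∃ β > (0:ℝ), ∀ z ∈ Set.Icc (0:ℝ) 1, ∀ n : ℕ, 1 ≤ n →
      ∃ S : Finset (Fin n → Bool),
        2 ^ n * ((1 - z) - β * (2:ℝ) ^ (-(n:ℝ)/3.639)) ≤ (S.card : ℝ) ∧
        ∑ b ∈ S, becF n b z ≤ pe := by
  obtain ⟨hp0, hp1⟩ := hpe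
  obtain ⟨G, K, δ, hK, hδ, hGK, hGs, hGc⟩ := exists_G
  refine ⟨K / (δ * pe), by positivity, ?_⟩
  rintro z ⟨h0, h1⟩ n -
  have h2n : (0 : ℝ) < 2 ^ n := by positivity
  set τ : ℝ := pe / 2 ^ n with hτ
  have hτ0 : 0 < τ := by positivity
  refine ⟨Finset.univ.filter (fun b => becF n b z ≤ τ), ?_, ?_⟩
  · set S : Finset (Fin n → Bool) := Finset.univ.filter (fun b => becF n b z ≤ τ) with hS
    -- lower bound for the small power off `S`
    have hτa : pe / ((2 : ℝ) ^ ((1 : ℝ) / 20000)) ^ n ≤ τ ^ ((1 : ℝ) / 20000) := by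
      rw [hτ, Real.div_rpow hp0.le h2n.le]
      have e1 : ((2 : ℝ) ^ n) ^ ((1 : ℝ) / 20000) = ((2 : ℝ) ^ ((1 : ℝ) / 20000)) ^ n := by
        rw [← Real.rpow_natCast, ← Real.rpow_natCast, ← Real.rpow_mul (by norm_num),
          ← Real.rpow_mul (by norm_num), mul_comm]
      rw [e1]
      have e2 : pe ≤ pe ^ ((1 : ℝ) / 20000) := by
        have := Real.rpow_le_rpow_of_exponent_ge' hp0.le hp1.le
          (show (0 : ℝ) ≤ 1 / 20000 by norm_num) (show (1 / 20000 : ℝ) ≤ 1 by norm_num)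
        rwa [Real.rpow_one] at this
      gcongr
    set A : ℝ := ((2 : ℝ) ^ ((1 : ℝ) / 20000)) ^ n with hA
    have hA0 : 0 < A := by positivity
    have point : ∀ b : Fin n → Bool, 1 - becF n b z ≤
        (if becF n b z ≤ τ then (1 : ℝ) else 0) + A / (δ * pe) * G (becF n b z) := by
      intro b
      obtain ⟨f0, f1⟩ := becF_mem n b h0 h1
      have g := hGs _ f0 f1
      generalize becF n b z = f at *
      have sg0 : 0 ≤ sg f := mul_nonneg (Real.rpow_nonneg f0 _) (by linarith)
      have hc : 0 ≤ A / (δ * pe) := by positivity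
      split_ifs with h
      · have : 0 ≤ G f := le_trans (by positivity) g
        have := mul_nonneg hc this
        linarith
      · have k1 : pe / A ≤ f ^ ((1 : ℝ) / 20000) :=
          hτa.trans (Real.rpow_le_rpow hτ0.le (not_le.1 h).le (by norm_num))
        have k2 : pe / A * (1 - f) ≤ sg f := mul_le_mul_of_nonneg_right k1 (by linarith)
        have k3 := mul_le_mul_of_nonneg_left ((mul_le_mul_of_nonneg_left k2 hδ.le).trans g) hc
        have k4 : A / (δ * pe) * (δ * (pe / A * (1 - f))) = 1 - f := by
          field_simp
        linarith
    have sum1 := Finset.sum_le_sum (s := Finset.univ) (fun b _ => point b)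
    rw [sum_one_sub, Finset.sum_add_distrib, ← Finset.mul_sum, Finset.sum_boole] at sum1
    have sum2 := sum_G hGc n h0 h1
    have hGz := hGK z h0 h1
    have hc : 0 ≤ A / (δ * pe) := by positivity
    have sum3 : A / (δ * pe) * ∑ b : Fin n → Bool, G (becF n b z)
        ≤ A / (δ * pe) * ((2 * 0.8265) ^ n * K) :=
      mul_le_mul_of_nonneg_left
        (sum2.trans (mul_le_mul_of_nonneg_left hGz (by positivity))) hc
    have rate : (0.8265 : ℝ) ^ n * A ≤ (2 : ℝ) ^ (-(n : ℝ) / 3.639) := by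
      rw [hA, ← mul_pow]
      have := pow_le_pow_left₀ (by positivity) rate_bound n
      refine this.trans (le_of_eq ?_)
      rw [← Real.rpow_natCast, ← Real.rpow_mul (by norm_num)]
      congr 1
      ring
    have e5 : A / (δ * pe) * ((2 * 0.8265) ^ n * K) = 2 ^ n * (K / (δ * pe) * (0.8265 ^ n * A)) := by
      rw [mul_pow]
      ring
    have r2 : 2 ^ n * (K / (δ * pe) * (0.8265 ^ n * A))
        ≤ 2 ^ n * (K / (δ * pe) * (2 : ℝ) ^ (-(n : ℝ) / 3.639)) := by
      gcongr
    rw [mul_sub]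
    linarith
  · calc ∑ b ∈ Finset.univ.filter (fun b => becF n b z ≤ τ), becF n b z
        ≤ ∑ b ∈ Finset.univ.filter (fun b : Fin n → Bool => becF n b z ≤ τ), τ :=
          Finset.sum_le_sum fun b hb => (Finset.mem_filter.1 hb).2
      _ ≤ ∑ b : Fin n → Bool, τ :=
          Finset.sum_le_sum_of_subset_of_nonneg (Finset.filter_subset _ _) fun _ _ _ => hτ0.le
      _ = pe := by
          rw [Finset.sum_const, Finset.card_univ]
          simp only [Fintype.card_fun, Fintype.card_bool, Fintype.card_fin, nsmul_eq_mul]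
          push_cast
          rw [hτ]
          field_simp
end

section
/- Let z, z' ∈ (0,1) with z ≤ z'. Then for every n ≥ 0 and every binary string b ∈ {0,1}^n, F_b(z) ≤ (F_b(z'))^η, where η = (log z)/(log z') ( = (log₂ z)/(log₂ z') ≥ 1). -/
theorem becStep_aux (p : ℝ) (hp : 1 ≤ p) (l : List Bool) : ∀ x y : ℝ, 0 ≤ x → x ≤ 1 → 0 ≤ y → y ≤ 1 →
    x ≤ y ^ p → l.foldl becStep x ≤ (l.foldl becStep y) ^ p := by
  induction l with
  | nil => intro x y _ _ _ _ h; simpa using h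
  | cons c l ih =>
    intro x y hx hx1 hy hy1 h
    have hp0 : 0 ≤ p := by linarith
    have hw0 : 0 ≤ y ^ p := Real.rpow_nonneg hy p
    have hw1 : y ^ p ≤ 1 := Real.rpow_le_one hy hy1 hp0
    simp only [List.foldl_cons]
    cases c with
    | true =>
      simp only [becStep, if_true]
      apply ih
      · positivity
      · nlinarith
      · positivity
      · nlinarith
      · rw [pow_two y, Real.mul_rpow hy hy]
        nlinarith
    | false =>
      simp only [becStep, Bool.false_eq_true, if_false]
      apply ih
      · nlinarith
      · nlinarith [sq_nonneg (x - 1)]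
      · nlinarith
      · nlinarith [sq_nonneg (y - 1)]
      · have e : 2 * y - y ^ 2 = y * (1 + (1 - y)) := by ring
        rw [e, Real.mul_rpow hy (by linarith)]
        have h1 : 1 + p * (1 - y) ≤ (1 + (1 - y)) ^ p :=
          one_add_mul_self_le_rpow_one_add (by linarith) hp
        have h2 : 1 + p * (y - 1) ≤ (1 + (y - 1)) ^ p :=
          one_add_mul_self_le_rpow_one_add (by linarith) hp
        rw [show 1 + (y - 1) = y by ring] at h2
        calc 2 * x - x ^ 2 ≤ y ^ p * (2 - y ^ p) := by nlinarith
          _ ≤ _ := by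
            apply mul_le_mul_of_nonneg_left _ hw0
            linarith

/-- **Scaling of the synthetic Bhattacharyya parameters for the BEC.**
For `z ≤ z'` in `(0,1)`, every `n ≥ 0` and every binary string `b` of length `n`,
`F_b(z) ≤ (F_b(z'))^η` where `η = (log z)/(log z')`. -/
theorem becF_power_bound
    (z z' : ℝ) (hz : z ∈ Set.Ioo (0:ℝ) 1) (hz' : z' ∈ Set.Ioo (0:ℝ) 1)
    (hle : z ≤ z') (n : ℕ) (b : Fin n → Bool) :
    becF n b z ≤ becF n b z' ^ (Real.log z / Real.log z') := by
  obtain ⟨h0, h1⟩ := hz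
  obtain ⟨h0', h1'⟩ := hz'
  have hl' : Real.log z' < 0 := Real.log_neg h0' h1'
  have hl : Real.log z ≤ Real.log z' := Real.log_le_log h0 hle
  unfold becF
  apply becStep_aux _ _ _ _ _ h0.le h1.le h0'.le h1'.le
  · rw [Real.rpow_def_of_pos h0', mul_div_cancel₀ _ hl'.ne, Real.exp_log h0]
  · rw [le_div_iff_of_neg hl']
    linarith
end

section
/- Let ρ₁ ∈ (0, 1/2] and let h : [0,1] → [0,1] satisfy h(0) = h(1) = 0, h(x) > 0 for all x ∈ (0,1), and h(x²) + h(y) ≤ 2^(1−ρ₁)·h(x) for all x ∈ (0,1) and all y ∈ [x√(2−x²), 2x−x²]. Let α ∈ (0, 1/2), δ ∈ (0,1), ε₁, ε₂ ∈ (0,1) and c₃ ≥ 0 be such that t(x) ≤ 2^(−ρ₁) for all x ∈ [0, ε₁] ∪ [1 − ε₂, 1], and (x(1−x))^α ≤ c₃·h(x) for all x ∈ (ε₁, 1 − ε₂), where t(x) = (1/2)·((x(1+x))^α + ((2−x)(1−x)^{1/3})^α). Define g(x) = (1−δ)·h(x) + δ·(x(1−x))^α. Then for every x ∈ (0,1)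 and every y ∈ [x√(2−x²), 2x−x²], g(x²) + g(y) ≤ 2·(2^(−ρ₁) + √2·(δ/(1−δ))·c₃)·g(x). -/
theorem le_of_sq_le_sq_aux {a b : ℝ} (h : a ^ 2 ≤ b ^ 2) (hb : 0 ≤ b) : a ≤ b :=
  abs_le_of_sq_le_sq' h hb |>.2

theorem poly_aux (s : ℝ) (h0 : 0 ≤ s) (h1 : s ≤ 1) :
    0 ≤ 2 - 4 * s ^ 2 - s ^ 4 + 4 * s ^ 5 - s ^ 8 := by
  have e : 2 - 4 * s ^ 2 - s ^ 4 + 4 * s ^ 5 - s ^ 8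
      = (1 - s) ^ 2 * (2 + 4 * s + 2 * s ^ 2 - 3 * s ^ 4 - 2 * s ^ 5 - s ^ 6) := by ring
  rw [e]
  apply mul_nonneg (sq_nonneg _)
  have a4 : s ^ 4 ≤ s := pow_le_of_le_one h0 h1 (by norm_num)
  have a5 : s ^ 5 ≤ 1 := pow_le_one₀ h0 h1
  have a6 : s ^ 6 ≤ s := pow_le_of_le_one h0 h1 (by norm_num)
  nlinarith [sq_nonneg s]

theorem y_aux (x : ℝ) (hx0 : 0 < x) (hx1 : x < 1) (y : ℝ)
    (hy : y ∈ Set.Icc (x * Real.sqrt (2 - x ^ 2)) (2 * x - x ^ 2)) :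
    y * (1 - y) ≤ (x * (1 - x)) * ((2 - x) * (1 - x) ^ ((1:ℝ)/3)) := by
  obtain ⟨hy1, hy2⟩ := hy
  set s := (1 - x) ^ ((1:ℝ)/3) with hs
  have hs0 : 0 ≤ s := Real.rpow_nonneg (by linarith) _
  have hs1 : s ≤ 1 := Real.rpow_le_one (by linarith) (by linarith) (by norm_num)
  have hs3 : s ^ 3 = 1 - x := by
    rw [hs, ← Real.rpow_natCast, ← Real.rpow_mul (by linarith)]
    norm_num
  have hxs : x = 1 - s ^ 3 := by linarith
  have hp := poly_aux s hs0 hs1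
  have key : 1 - s ^ 4 ≤ x * Real.sqrt (2 - x ^ 2) := by
    have hnn : 0 ≤ 2 - x ^ 2 := by nlinarith
    refine le_of_sq_le_sq_aux ?_ (by positivity)
    rw [mul_pow, Real.sq_sqrt hnn, hxs]
    have : 0 ≤ s ^ 4 * (2 - 4 * s ^ 2 - s ^ 4 + 4 * s ^ 5 - s ^ 8) := by positivity
    nlinarith
  have hy0 : 0 ≤ y := le_trans (by positivity) hy1
  calc y * (1 - y) ≤ (2 * x - x ^ 2) * s ^ 4 :=
        mul_le_mul hy2 (by linarith) (by nlinarith) (by nlinarith)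
    _ = (x * s ^ 3) * ((2 - x) * s) := by ring
    _ = _ := by rw [hs3]

/-- **Eigenvalue-type bound for the perturbed function `g`.**
Under the stated hypotheses on `ρ₁`, `h`, `α`, `δ`, `ε₁`, `ε₂`, `c₃` and the auxiliary
function `t(x) = (1/2)·((x(1+x))^α + ((2−x)(1−x)^{1/3})^α)`, the function
`g(x) = (1−δ)·h(x) + δ·(x(1−x))^α` satisfies
`g(x²) + g(y) ≤ 2·(2^(−ρ₁) + √2·(δ/(1−δ))·c₃)·g(x)` for every `x ∈ (0,1)` and every
`y ∈ [x√(2−x²), 2x−x²]`. -/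
theorem g_supremum_bound
    (ρ₁ : ℝ) (hρ₁ : ρ₁ ∈ Set.Ioc (0:ℝ) (1/2))
    (h : ℝ → ℝ)
    (hmap : ∀ x ∈ Set.Icc (0:ℝ) 1, h x ∈ Set.Icc (0:ℝ) 1)
    (h0 : h 0 = 0) (h1 : h 1 = 0)
    (hpos : ∀ x ∈ Set.Ioo (0:ℝ) 1, 0 < h x)
    (hsup : ∀ x ∈ Set.Ioo (0:ℝ) 1,
      ∀ y ∈ Set.Icc (x * Real.sqrt (2 - x ^ 2)) (2 * x - x ^ 2),
        h (x ^ 2) + h y ≤ (2:ℝ) ^ (1 - ρ₁) * h x)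
    (α : ℝ) (hα : α ∈ Set.Ioo (0:ℝ) (1/2))
    (δ : ℝ) (hδ : δ ∈ Set.Ioo (0:ℝ) 1)
    (ε₁ : ℝ) (hε₁ : ε₁ ∈ Set.Ioo (0:ℝ) 1)
    (ε₂ : ℝ) (hε₂ : ε₂ ∈ Set.Ioo (0:ℝ) 1)
    (c₃ : ℝ) (hc₃ : 0 ≤ c₃)
    (ht : ∀ x ∈ Set.Icc (0:ℝ) ε₁ ∪ Set.Icc (1 - ε₂) 1,
      (1/2) * ((x * (1 + x)) ^ α + ((2 - x) * (1 - x) ^ ((1:ℝ)/3)) ^ α) ≤ (2:ℝ) ^ (-ρ₁))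
    (hc : ∀ x ∈ Set.Ioo ε₁ (1 - ε₂), (x * (1 - x)) ^ α ≤ c₃ * h x)
    (g : ℝ → ℝ) (hg : ∀ x, g x = (1 - δ) * h x + δ * (x * (1 - x)) ^ α) :
    ∀ x ∈ Set.Ioo (0:ℝ) 1,
      ∀ y ∈ Set.Icc (x * Real.sqrt (2 - x ^ 2)) (2 * x - x ^ 2),
        g (x ^ 2) + g y ≤
          2 * ((2:ℝ) ^ (-ρ₁) + Real.sqrt 2 * (δ / (1 - δ)) * c₃) * g x := by
  intro x hx y hy
  obtain ⟨hx0, hx1⟩ := hx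
  obtain ⟨hα0, hα1⟩ := hα
  obtain ⟨hδ0, hδ1⟩ := hδ
  have hH := hsup x ⟨hx0, hx1⟩ y hy
  have hhx := hpos x ⟨hx0, hx1⟩
  have hY := y_aux x hx0 hx1 y hy
  have hy0 : 0 ≤ y := le_trans (by positivity) hy.1
  have hy1 : y ≤ 1 := by nlinarith [hy.2, sq_nonneg (1 - x)]
  have hxx : 0 ≤ x * (1 - x) := mul_nonneg hx0.le (by linarith)
  have hs0 : 0 ≤ (1 - x) ^ ((1:ℝ)/3) := Real.rpow_nonneg (by linarith) _
  have hs1 : (1 - x) ^ ((1:ℝ)/3) ≤ 1 :=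
    Real.rpow_le_one (by linarith) (by linarith) (by norm_num)
  have hB0 : 0 ≤ (2 - x) * (1 - x) ^ ((1:ℝ)/3) := mul_nonneg (by linarith) hs0
  have hB2 : (2 - x) * (1 - x) ^ ((1:ℝ)/3) ≤ 2 := by nlinarith
  have hA0 : 0 ≤ x * (1 + x) := by positivity
  have hA2 : x * (1 + x) ≤ 2 := by nlinarith
  have hF1 : (x ^ 2 * (1 - x ^ 2)) ^ α = (x * (1 - x)) ^ α * (x * (1 + x)) ^ α := by
    rw [← Real.mul_rpow hxx hA0]
    congr 1
    ring
  have hF2 : (y * (1 - y)) ^ α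
      ≤ (x * (1 - x)) ^ α * ((2 - x) * (1 - x) ^ ((1:ℝ)/3)) ^ α := by
    rw [← Real.mul_rpow hxx hB0]
    exact Real.rpow_le_rpow (mul_nonneg hy0 (by linarith)) hY hα0.le
  have hA := Real.rpow_le_rpow hA0 hA2 hα0.le
  have hB := Real.rpow_le_rpow hB0 hB2 hα0.le
  have h2α : (2:ℝ) ^ α ≤ Real.sqrt 2 := by
    rw [Real.sqrt_eq_rpow]
    exact Real.rpow_le_rpow_of_exponent_le (by norm_num) hα1.le
  have h2 : (2:ℝ) ^ (1 - ρ₁) = 2 * (2:ℝ) ^ (-ρ₁) := by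
    rw [sub_eq_add_neg, Real.rpow_add (by norm_num), Real.rpow_one]
  rw [h2] at hH
  have hF0 : 0 ≤ (x * (1 - x)) ^ α := Real.rpow_nonneg hxx _
  have hr0 : 0 ≤ (2:ℝ) ^ (-ρ₁) := by positivity
  have hq0 : 0 ≤ Real.sqrt 2 := Real.sqrt_nonneg 2
  have hT := ht x
  have hC := hc x
  rw [hg, hg, hg, hF1]
  generalize (x * (1 - x)) ^ α = F at *
  generalize (x * (1 + x)) ^ α = A at *
  generalize ((2 - x) * (1 - x) ^ ((1:ℝ)/3)) ^ α = B at *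
  generalize (y * (1 - y)) ^ α = Fy at *
  generalize (2:ℝ) ^ (-ρ₁) = r at *
  generalize Real.sqrt 2 = q at *
  have h1δ : 0 < 1 - δ := by linarith
  have hH' := mul_le_mul_of_nonneg_left hH h1δ.le
  have hF2' := mul_le_mul_of_nonneg_left hF2 hδ0.le
  have hd0 : 0 ≤ δ / (1 - δ) := by positivity
  have hδF : 0 ≤ δ * F := by positivity
  by_cases hcase : x ∈ Set.Icc (0:ℝ) ε₁ ∪ Set.Icc (1 - ε₂) 1
  · have hT' := mul_le_mul_of_nonneg_left (hT hcase) hδF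
    have : 0 ≤ 2 * (q * (δ / (1 - δ)) * c₃) * ((1 - δ) * h x + δ * F) := by positivity
    nlinarith
  · have hx' : x ∈ Set.Ioo ε₁ (1 - ε₂) := by
      simp only [Set.mem_union, Set.mem_Icc, not_or, not_and, not_le] at hcase
      refine ⟨hcase.1 hx0.le, ?_⟩
      by_contra hcon
      exact absurd (hcase.2 (not_lt.mp hcon)) (not_lt.mpr hx1.le)
    have hC' := mul_le_mul_of_nonneg_left (hC hx') (mul_nonneg hq0 hδ0.le)
    have hAq := mul_le_mul_of_nonneg_left (hA.trans h2α) hδF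
    have hBq := mul_le_mul_of_nonneg_left (hB.trans h2α) hδF
    have e : δ / (1 - δ) * (1 - δ) = δ := div_mul_cancel₀ _ h1δ.ne'
    have e2 : 2 * (r + q * (δ / (1 - δ)) * c₃) * ((1 - δ) * h x + δ * F)
        = 2 * r * ((1 - δ) * h x) + 2 * r * (δ * F) + 2 * (q * δ * (c₃ * h x))
          + 2 * (q * (δ / (1 - δ)) * c₃) * (δ * F) := by
      linear_combination 2 * q * c₃ * h x * e
    have p1 : 0 ≤ 2 * r * (δ * F) := by positivity
    have p2 : 0 ≤ 2 * (q * (δ / (1 - δ)) * c₃) * (δ * F) := by positivity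
    rw [e2]
    linarith
end

section
/- Let z ∈ [0,1] and let (Z_n) be the BEC Bhattacharyya process with initial value z. Let g : [0,1] → ℝ be measurable with g ≥ 0 and g(0) = g(1) = 0, and let L ≥ 0 be such that g(x²) + g(2x − x²) ≤ 2·L·g(x) for every x ∈ (0,1). Then for every n ≥ 0, E[g(Z_n)] ≤ L^n · g(z). -/
/-- **One-step supremum bound iterates (BEC).**
Let `(Z_n)` be the BEC Bhattacharyya process with initial value `z ∈ [0,1]`.  If
`g : [0,1] → ℝ` is measurable, nonnegative, vanishes at `0` and `1`, and satisfies
`g(x²) + g(2x − x²) ≤ 2·L·g(x)` on `(0,1)` for some `L ≥ 0`, then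
`E[g(Z_n)] ≤ L^n·g(z)` for every `n ≥ 0`, where the expectation is the uniform
average over the `2^n` binary strings of length `n`. -/
theorem bec_expectation_iterate
    (z : ℝ) (hz : z ∈ Set.Icc (0:ℝ) 1)
    (g : ℝ → ℝ) (hmeas : Measurable g)
    (hnonneg : ∀ x ∈ Set.Icc (0:ℝ) 1, 0 ≤ g x)
    (hg0 : g 0 = 0) (hg1 : g 1 = 0)
    (L : ℝ) (hL : 0 ≤ L)
    (hsup : ∀ x ∈ Set.Ioo (0:ℝ) 1, g (x ^ 2) + g (2 * x - x ^ 2) ≤ 2 * L * g x) :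
    ∀ n : ℕ, (∑ b : Fin n → Bool, g (becF n b z)) / 2 ^ n ≤ L ^ n * g z := by
  have hstep : ∀ x ∈ Set.Icc (0:ℝ) 1, g (x ^ 2) + g (2 * x - x ^ 2) ≤ 2 * L * g x := by
    intro x hx
    rcases eq_or_lt_of_le hx.1 with h | h
    · subst h; simp [hg0]
    rcases eq_or_lt_of_le hx.2 with h' | h'
    · subst h'; norm_num [hg1]
    exact hsup x ⟨h, h'⟩
  intro n
  induction n generalizing z with
  | zero => simp [becF]
  | succ n ih =>
    have hsplit : ∑ b : Fin (n + 1) → Bool, g (becF (n + 1) b z)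
        = ∑ b : Fin n → Bool, g (becF n b (z ^ 2))
          + ∑ b : Fin n → Bool, g (becF n b (2 * z - z ^ 2)) := by
      rw [← (Fin.consEquiv (fun _ => Bool)).sum_comp, Fintype.sum_prod_type]
      simp [Fin.consEquiv, becF, List.ofFn_succ, becStep]
    have h0 := hz.1
    have h1 := hz.2
    have i1 := ih (z ^ 2) ⟨by positivity, by nlinarith⟩
    have i2 := ih (2 * z - z ^ 2) ⟨by nlinarith, by nlinarith [sq_nonneg (1 - z)]⟩
    have h3 := mul_le_mul_of_nonneg_left (hstep z hz) (pow_nonneg hL n)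
    rw [hsplit, pow_succ (2:ℝ), ← div_div, add_div, pow_succ L]
    linarith
end

section
/- Let a, b ∈ [0,1] and let η ≥ 2 be a real number. If a ≤ b^η, then a(2 − a) ≤ (b·√(2 − b²))^η. (This is the induction step showing that the relation Z_n^{(i)}(W) ≤ Z_n^{(i)}(W')^η between the Bhattacharyya parameters of polarized binary memoryless symmetric channels is preserved under the 'minus' polarization step when η ≥ 2.) -/
/-- **Induction step for the 'minus' polarization transform (general BMSC).**
If `a, b ∈ [0,1]`, `η ≥ 2` and `a ≤ b^η`, then `a(2 − a) ≤ (b·√(2 − b²))^η`.  This is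
the step showing that `Z_n^{(i)}(W) ≤ Z_n^{(i)}(W')^η` is preserved under the 'minus'
polarization step for binary memoryless symmetric channels when `η ≥ 2`. -/
theorem minus_step_power_bound_bmsc
    (a b : ℝ) (ha : a ∈ Set.Icc (0:ℝ) 1) (hb : b ∈ Set.Icc (0:ℝ) 1)
    (η : ℝ) (hη : 2 ≤ η) (hab : a ≤ b ^ η) :
    a * (2 - a) ≤ (b * Real.sqrt (2 - b ^ 2)) ^ η := by
  obtain ⟨ha0, ha1⟩ := ha
  obtain ⟨hb0, hb1⟩ := hb
  have hx1 : b ^ 2 ≤ 1 := by nlinarith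
  have hx0 : 0 ≤ b ^ 2 := sq_nonneg b
  have hp : 1 ≤ η / 2 := by linarith
  have h1 := one_add_mul_self_le_rpow_one_add (s := b ^ 2 - 1) (by linarith) hp
  have h2 := one_add_mul_self_le_rpow_one_add (s := 1 - b ^ 2) (by linarith) hp
  rw [show 1 + (b ^ 2 - 1) = b ^ 2 by ring] at h1
  rw [show 1 + (1 - b ^ 2) = 2 - b ^ 2 by ring] at h2
  have e1 : (b ^ 2) ^ (η / 2) = b ^ η := by
    rw [← Real.rpow_natCast, ← Real.rpow_mul hb0]
    congr 1
    push_cast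
    ring
  have e2 : (Real.sqrt (2 - b ^ 2)) ^ η = (2 - b ^ 2) ^ (η / 2) := by
    rw [Real.sqrt_eq_rpow, ← Real.rpow_mul (by linarith)]
    congr 1
    ring
  rw [Real.mul_rpow hb0 (Real.sqrt_nonneg _), e2]
  rw [e1] at h1
  have hc1 : b ^ η ≤ 1 := Real.rpow_le_one hb0 hb1 (by linarith)
  have hc0 : 0 ≤ b ^ η := Real.rpow_nonneg hb0 η
  calc a * (2 - a) ≤ b ^ η * (2 - b ^ η) := by nlinarith
    _ ≤ _ := mul_le_mul_of_nonneg_left (by linarith) hc0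
end

section
/- Let a, b ∈ [0,1] and let η ≥ 1 be a real number. If a ≤ b^η, then a(2 − a) ≤ (b(2 − b))^η. (This is the induction step showing that the relation Z_n^{(i)}(z) ≤ Z_n^{(i)}(z')^η between the Bhattacharyya parameters of polarized binary erasure channels is preserved under the 'minus' polarization step z ↦ 2z − z² when η ≥ 1.) -/
/-- **Induction step for the 'minus' polarization transform (BEC).**
If `a, b ∈ [0,1]`, `η ≥ 1` and `a ≤ b^η`, then `a(2 − a) ≤ (b(2 − b))^η`.  This is the
step showing that `Z_n^{(i)}(z) ≤ Z_n^{(i)}(z')^η` is preserved under the 'minus'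
polarization step `z ↦ 2z − z²` for binary erasure channels when `η ≥ 1`. -/
theorem minus_step_power_bound_bec
    (a b : ℝ) (ha : a ∈ Set.Icc (0:ℝ) 1) (hb : b ∈ Set.Icc (0:ℝ) 1)
    (η : ℝ) (hη : 1 ≤ η) (hab : a ≤ b ^ η) :
    a * (2 - a) ≤ (b * (2 - b)) ^ η := by
  obtain ⟨ha0, ha1⟩ := ha
  obtain ⟨hb0, hb1⟩ := hb
  have h1 := one_add_mul_self_le_rpow_one_add (s := b - 1) (by linarith) hη
  have h2 := one_add_mul_self_le_rpow_one_add (s := 1 - b) (by linarith) hη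
  rw [show 1 + (b - 1) = b by ring] at h1
  rw [show 1 + (1 - b) = 2 - b by ring] at h2
  have hc0 : 0 ≤ b ^ η := Real.rpow_nonneg hb0 η
  have hc1 : b ^ η ≤ 1 := Real.rpow_le_one hb0 hb1 (by linarith)
  rw [Real.mul_rpow hb0 (by linarith)]
  have h3 : 2 - b ^ η ≤ (2 - b) ^ η := by linarith
  calc a * (2 - a) ≤ b ^ η * (2 - b ^ η) := by
        nlinarith [mul_nonneg (sub_nonneg.2 hab) (show 0 ≤ 2 - a - b ^ η by linarith)]
    _ ≤ b ^ η * (2 - b) ^ η := mul_le_mul_of_nonneg_left h3 hc0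
end

section
/- Let η > 0 be a real number. Then the inequality 2 − x^η ≤ (2 − x²)^{η/2} holds for every x ∈ [0,1] if and only if η ≥ 2. -/
/-- For `η > 0`, the inequality `2 − x^η ≤ (2 − x²)^{η/2}` holds for every `x ∈ [0,1]`
if and only if `η ≥ 2`. -/
theorem two_sub_rpow_le_iff_two_le
    (η : ℝ) (hη : 0 < η) :
    (∀ x ∈ Set.Icc (0:ℝ) 1, 2 - x ^ η ≤ (2 - x ^ 2) ^ (η / 2)) ↔ 2 ≤ η := by
  constructor
  · intro h
    have h0 := h 0 (by simp)
    rw [Real.zero_rpow hη.ne'] at h0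
    norm_num at h0
    by_contra hlt
    have h1 : (2:ℝ) ^ (η / 2) < 2 ^ (1:ℝ) :=
      Real.rpow_lt_rpow_of_exponent_lt (by norm_num) (by linarith)
    rw [Real.rpow_one] at h1
    linarith
  · intro h x hx
    obtain ⟨hx0, hx1⟩ := hx
    have hp : 1 ≤ η / 2 := by linarith
    have hsq : x ^ 2 ≤ 1 := by nlinarith
    have a := one_add_mul_self_le_rpow_one_add (s := x ^ 2 - 1) (by nlinarith [sq_nonneg x]) hp
    have b := one_add_mul_self_le_rpow_one_add (s := 1 - x ^ 2) (by linarith) hp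
    have e1 : 1 + (x ^ 2 - 1) = x ^ 2 := by ring
    have e2 : 1 + (1 - x ^ 2) = 2 - x ^ 2 := by ring
    have e3 : (x ^ 2) ^ (η / 2) = x ^ η := by
      rw [← Real.rpow_natCast, ← Real.rpow_mul hx0]
      congr 1
      push_cast
      ring
    rw [e1, e3] at a
    rw [e2] at b
    linarith
end

section
/- For every x ∈ [0,1], 1 − x·√(2 − x²) ≤ (1 − x)^{4/3}. -/
/-- For every `x ∈ [0,1]`, `1 − x·√(2 − x²) ≤ (1 − x)^{4/3}`. -/
theorem one_sub_mul_sqrt_le_rpow (x : ℝ) (hx : x ∈ Set.Icc (0:ℝ) 1) :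
    1 - x * Real.sqrt (2 - x ^ 2) ≤ (1 - x) ^ ((4:ℝ) / 3) := by
  obtain ⟨h0, h1⟩ := hx
  have ht : 0 ≤ 1 - x := by linarith
  obtain ⟨s, hs⟩ : ∃ s : ℝ, s = (1 - x) ^ ((1:ℝ) / 3) := ⟨_, rfl⟩
  have s0 : 0 ≤ s := hs ▸ Real.rpow_nonneg ht _
  have s1 : s ≤ 1 := hs ▸ Real.rpow_le_one ht (by linarith) (by norm_num)
  have h3 : s ^ 3 = 1 - x := by
    rw [hs, ← Real.rpow_natCast, ← Real.rpow_mul ht]; norm_num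
  have h4 : (1 - x) ^ ((4:ℝ) / 3) = s ^ 4 := by
    rw [hs, ← Real.rpow_natCast, ← Real.rpow_mul ht]; norm_num
  rw [h4]
  have hx2 : x = 1 - s ^ 3 := by linarith
  have hq : s ^ 6 + 2 * s ^ 5 + 3 * s ^ 4 - 2 * s ^ 2 - 4 * s - 2 ≤ 0 := by
    have a1 : s ^ 6 ≤ s ^ 2 := pow_le_pow_of_le_one s0 s1 (by norm_num)
    have a2 : s ^ 5 ≤ s ^ 1 := pow_le_pow_of_le_one s0 s1 (by norm_num)
    have a3 : s ^ 4 ≤ s ^ 2 := pow_le_pow_of_le_one s0 s1 (by norm_num)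
    have a4 : s ^ 4 ≤ s ^ 1 := pow_le_pow_of_le_one s0 s1 (by norm_num)
    linarith
  have hp : 0 ≤ s ^ 4 * ((s - 1) ^ 2 *
      -(s ^ 6 + 2 * s ^ 5 + 3 * s ^ 4 - 2 * s ^ 2 - 4 * s - 2)) :=
    mul_nonneg (by positivity) (mul_nonneg (by positivity) (by linarith))
  have key : 1 - s ^ 4 ≤ x * Real.sqrt (2 - x ^ 2) := by
    apply abs_le_of_sq_le_sq' _ (by positivity) |>.2
    rw [mul_pow, Real.sq_sqrt (by nlinarith)]
    rw [hx2]
    nlinarith [hp]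
  linarith
end

section
/- For every α ∈ (0, 1/2), the function t(x) = (1/2)·((x(1+x))^α + ((2−x)(1−x)^{1/3})^α) is concave on the interval (0,1). -/
/-- Tangent form of the weighted AM-GM inequality. -/
theorem aux_tangent (p q : ℝ) (hp : 0 ≤ p) (hq : 0 ≤ q) (hpq : p + q ≤ 1)
    (u v a b : ℝ) (hu : 0 < u) (hv : 0 < v) (ha : 0 < a) (hb : 0 < b) :
    a ^ p * b ^ q ≤ (p * (a / u) + q * (b / v) + (1 - p - q)) * (u ^ p * v ^ q) := by
  have h := Real.geom_mean_le_arith_mean3_weighted hp hq (by linarith : 0 ≤ 1 - p - q)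
    (div_pos ha hu).le (div_pos hb hv).le zero_le_one (by ring)
  rw [Real.one_rpow, mul_one, mul_one, Real.div_rpow ha.le hu.le, Real.div_rpow hb.le hv.le] at h
  have hU := Real.rpow_pos_of_pos hu p
  have hV := Real.rpow_pos_of_pos hv q
  have h2 := mul_le_mul_of_nonneg_right h (mul_pos hU hV).le
  have e : a ^ p / u ^ p * (b ^ q / v ^ q) * (u ^ p * v ^ q) = a ^ p * b ^ q := by
    field_simp
  rwa [e] at h2

/-- Joint concavity of `u ^ p * v ^ q` for `p + q ≤ 1`. -/
theorem aux_concave (p q : ℝ) (hp : 0 ≤ p) (hq : 0 ≤ q) (hpq : p + q ≤ 1)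
    (u v a b c d s t : ℝ) (ha : 0 < a) (hb : 0 < b) (hc : 0 < c) (hd : 0 < d)
    (hs : 0 ≤ s) (ht : 0 ≤ t) (hst : s + t = 1) (hu : u = s * a + t * c)
    (hv : v = s * b + t * d) (hu0 : 0 < u) (hv0 : 0 < v) :
    s * (a ^ p * b ^ q) + t * (c ^ p * d ^ q) ≤ u ^ p * v ^ q := by
  have h1 := mul_le_mul_of_nonneg_left (aux_tangent p q hp hq hpq u v a b hu0 hv0 ha hb) hs
  have h2 := mul_le_mul_of_nonneg_left (aux_tangent p q hp hq hpq u v c d hu0 hv0 hc hd) ht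
  have e1 : s * (a / u) + t * (c / u) = 1 := by
    rw [← mul_div_assoc, ← mul_div_assoc, ← add_div, ← hu, div_self hu0.ne']
  have e2 : s * (b / v) + t * (d / v) = 1 := by
    rw [← mul_div_assoc, ← mul_div_assoc, ← add_div, ← hv, div_self hv0.ne']
  refine (add_le_add h1 h2).trans (le_of_eq ?_)
  linear_combination (p * e1 + q * e2 + (1 - p - q) * hst) * (u ^ p * v ^ q)

/-- For every `α ∈ (0, 1/2)`, the function
`t(x) = (1/2)·((x(1+x))^α + ((2−x)(1−x)^{1/3})^α)` is concave on `(0,1)`. -/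
theorem t_concaveOn (α : ℝ) (hα : α ∈ Set.Ioo (0:ℝ) (1/2)) :
    ConcaveOn ℝ (Set.Ioo (0:ℝ) 1)
      (fun x => (1/2) * ((x * (1 + x)) ^ α + ((2 - x) * (1 - x) ^ ((1:ℝ)/3)) ^ α)) := by
  obtain ⟨h0, h1⟩ := hα
  have key : ∀ x ∈ Set.Ioo (0:ℝ) 1,
      (1/2) * ((x * (1 + x)) ^ α + ((2 - x) * (1 - x) ^ ((1:ℝ)/3)) ^ α)
      = (1/2) * (x ^ α * (1 + x) ^ α + (2 - x) ^ α * (1 - x) ^ (1 / 3 * α)) := by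
    rintro x ⟨hx0, hx1⟩
    have h3 : 0 ≤ 1 - x := by linarith
    rw [Real.mul_rpow hx0.le (by linarith), Real.mul_rpow (by linarith) (Real.rpow_nonneg h3 _),
      ← Real.rpow_mul h3]
  refine ⟨convex_Ioo 0 1, ?_⟩
  intro x hx y hy s t hs ht hst
  have hz := convex_Ioo (0:ℝ) 1 hx hy hs ht hst
  simp only [smul_eq_mul] at hz ⊢
  rw [key x hx, key y hy, key _ hz]
  obtain ⟨hx0, hx1⟩ := hx
  obtain ⟨hy0, hy1⟩ := hy
  obtain ⟨hz0, hz1⟩ := hz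
  have A := aux_concave α α h0.le h0.le (by linarith) (s * x + t * y) (1 + (s * x + t * y))
    x (1 + x) y (1 + y) s t hx0 (by linarith) hy0 (by linarith) hs ht hst rfl
    (by linear_combination -hst) hz0 (by linarith)
  have B := aux_concave α (1 / 3 * α) h0.le (by linarith) (by linarith)
    (2 - (s * x + t * y)) (1 - (s * x + t * y))
    (2 - x) (1 - x) (2 - y) (1 - y) s t (by linarith) (by linarith) (by linarith) (by linarith)
    hs ht hst (by linear_combination -2 * hst)
    (by linear_combination -hst) (by linarith) (by linarith)
  linarith
end
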